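/- Let n ≥ 1, 1 ≤ p < ∞, 0 < T < ∞, and let (φ′,ψ′) be a Littlewood–Paley family on ℝⁿ. There exists C > 0 (depending only on n, p, T, φ′, ψ′) such that for every Schwartz function f on ℝⁿ, the heat extension u(X,t) = (Γ(·,t)*f)(X) satisfies B_{−2/p, p}(f) ≤ C·( ∫_0^T ∫_{ℝⁿ} |u(X,t)|^p dX dt )^{1/p}. -/

import Mathlib

noncomputable section

open MeasureTheory Real Complex
open scoped ENNReal NNReal Real BigOperators

/-- Euclidean space `ℝⁿ`. -/
abbrev Rn (n : ℕ) : Type := EuclideanSpace ℝ (Fin n)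

/-- The space `ℝ^{n+1} = ℝⁿ × ℝ`, points written `(X, t)`. -/
abbrev Rn1 (n : ℕ) : Type := EuclideanSpace ℝ (Fin n) × ℝ

/-- Fourier transform on `ℝ^{n+1}`:
`𝓕f(ξ,τ) = ∫ e^{−2πi(X·ξ + tτ)} f(X,t) dX dt`. -/
def FT1 {n : ℕ} (f : Rn1 n → ℂ) (q : Rn1 n) : ℂ :=
  ∫ p : Rn1 n,
    Complex.exp (-(2 * (π : ℂ) * Complex.I) *
      (((∑ k, p.1 k * q.1 k) + p.2 * q.2 : ℝ) : ℂ)) * f p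

/-- Inverse Fourier transform on `ℝ^{n+1}`. -/
def IFT1 {n : ℕ} (f : Rn1 n → ℂ) (x : Rn1 n) : ℂ :=
  ∫ q : Rn1 n,
    Complex.exp ((2 * (π : ℂ) * Complex.I) *
      (((∑ k, q.1 k * x.1 k) + q.2 * x.2 : ℝ) : ℂ)) * f q

/-- The Fourier multiplier operator `f ↦ 𝓕⁻¹(m · 𝓕 f)` on `ℝ^{n+1}`. -/
def MOp {n : ℕ} (m : Rn1 n → ℂ) (f : Rn1 n → ℂ) : Rn1 n → ℂ :=
  IFT1 (fun q => m q * FT1 f q)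

/-- The symbol `m_α(ξ,τ) = (1 + 4π²|ξ|² + iτ)^{α/2}` (principal branch). -/
def mSym {n : ℕ} (α : ℝ) (q : Rn1 n) : ℂ :=
  (1 + 4 * (π : ℂ) ^ 2 * (‖q.1‖ : ℂ) ^ 2 + Complex.I * (q.2 : ℂ)) ^ ((α : ℂ) / 2)

/-- Partial derivative `∂_{X_k}`. -/
def dX {n : ℕ} (k : Fin n) (f : Rn1 n → ℂ) : Rn1 n → ℂ :=
  fun x => fderiv ℝ f x (EuclideanSpace.single k 1, 0)

/-- Partial derivative `∂_t`. -/
def dT {n : ℕ} (f : Rn1 n → ℂ) : Rn1 n → ℂ :=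
  fun x => fderiv ℝ f x (0, 1)

/-- Iterated spatial derivative `D_X^β` for a multi-index `β`. -/
def dXmulti {n : ℕ} (β : Fin n → ℕ) (f : Rn1 n → ℂ) : Rn1 n → ℂ :=
  (List.finRange n).foldr (fun k g => (dX k)^[β k] g) f

/-- The half time-derivative `D_t^{1/2} f = 𝓕⁻¹(|τ|^{1/2}·𝓕f)`. -/
def halfDt {n : ℕ} (f : Rn1 n → ℂ) : Rn1 n → ℂ :=
  MOp (fun q => ((|q.2| ^ ((1 : ℝ) / 2) : ℝ) : ℂ)) f

/-- The `Lᵖ(ℝ^{n+1})` norm (as a value in `ℝ≥0∞`), `p` a real exponent. -/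
def pNorm {n : ℕ} (p : ℝ) (f : Rn1 n → ℂ) : ℝ≥0∞ :=
  eLpNorm f (ENNReal.ofReal p) volume

/-- Multi-indices `β ∈ ℕⁿ` with `|β| = N`. -/
def multiIdx (n N : ℕ) : Finset (Fin n → ℕ) :=
  (Fintype.piFinset fun _ : Fin n => Finset.range (N + 1)).filter fun β => (∑ k, β k) = N

/-- Convolution on `ℝ^{n+1}`. -/
def conv1 {n : ℕ} (g f : Rn1 n → ℂ) : Rn1 n → ℂ :=
  fun x => ∫ y : Rn1 n, g (x - y) * f y

/-- A parabolic Littlewood–Paley family on `ℝ^{n+1}`. -/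
structure ParabolicLP (n : ℕ) where
  φ : SchwartzMap (Rn1 n) ℂ
  ψ : SchwartzMap (Rn1 n) ℂ
  ft_pos : ∀ q : Rn1 n,
    1 / 2 < ‖q.1‖ + |q.2| ^ ((1 : ℝ) / 2) → ‖q.1‖ + |q.2| ^ ((1 : ℝ) / 2) < 2 →
      0 < (FT1 (⇑φ) q).re ∧ (FT1 (⇑φ) q).im = 0
  ft_supp : ∀ q : Rn1 n,
    ¬(1 / 2 < ‖q.1‖ + |q.2| ^ ((1 : ℝ) / 2) ∧ ‖q.1‖ + |q.2| ^ ((1 : ℝ) / 2) < 2) →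
      FT1 (⇑φ) q = 0
  ft_sum : ∀ q : Rn1 n, q ≠ 0 →
    ∑' i : ℤ, FT1 (⇑φ) (((2 : ℝ) ^ (-i)) • q.1, ((2 : ℝ) ^ (-(2 * i))) * q.2) = 1
  ft_psi : ∀ q : Rn1 n,
    FT1 (⇑ψ) q =
      1 - ∑' i : ℕ,
        FT1 (⇑φ) (((2 : ℝ) ^ (-((i : ℤ) + 1))) • q.1, ((2 : ℝ) ^ (-(2 * ((i : ℤ) + 1)))) * q.2)

/-- The dilate `φ_i`, whose Fourier transform is `𝓕φ(2^{−i}ξ, 2^{−2i}τ)`. -/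
def lpPhi {n : ℕ} (P : ParabolicLP n) (i : ℕ) : Rn1 n → ℂ :=
  fun x => (((2 : ℝ) ^ (i * (n + 2)) : ℝ) : ℂ) *
    P.φ (((2 : ℝ) ^ i) • x.1, ((2 : ℝ) ^ (2 * i)) * x.2)

/-- Parabolic Besov norm `N_{s,p}(f)` on `ℝ^{n+1}`, `1 ≤ p < ∞`. -/
def pBesov {n : ℕ} (P : ParabolicLP n) (s p : ℝ) (f : Rn1 n → ℂ) : ℝ≥0∞ :=
  eLpNorm (conv1 (⇑P.ψ) f) (ENNReal.ofReal p) volume +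
  (∑' i : ℕ,
    (ENNReal.ofReal ((2 : ℝ) ^ (s * ((i : ℝ) + 1))) *
      eLpNorm (conv1 (lpPhi P (i + 1)) f) (ENNReal.ofReal p) volume) ^ p) ^ (1 / p)

/-- Parabolic Besov norm `N_{s,∞}(f)` on `ℝ^{n+1}`. -/
def pBesovInf {n : ℕ} (P : ParabolicLP n) (s : ℝ) (f : Rn1 n → ℂ) : ℝ≥0∞ :=
  max (eLpNorm (conv1 (⇑P.ψ) f) ⊤ volume)
    (⨆ i : ℕ, ENNReal.ofReal ((2 : ℝ) ^ (s * ((i : ℝ) + 1))) *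
      eLpNorm (conv1 (lpPhi P (i + 1)) f) ⊤ volume)

/-- The time interval `(0, T)` for `0 < T ≤ ∞`. -/
def tSet (T : ℝ≥0∞) : Set ℝ := {t : ℝ | 0 < t ∧ ENNReal.ofReal t < T}

/-- Lebesgue measure restricted to the strip `ℝⁿ × (0,T)`. -/
def stripMeasure (n : ℕ) (T : ℝ≥0∞) : Measure (Rn1 n) :=
  volume.restrict {x : Rn1 n | x.2 ∈ tSet T}

/-- The parabolic Sobolev norm `‖g‖_{W^{2i,i}_p(ℝⁿ_T)}`. -/
def wNorm {n : ℕ} (i : ℕ) (p : ℝ) (T : ℝ≥0∞) (g : Rn1 n → ℂ) : ℝ≥0∞ :=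
  ∑ l ∈ Finset.range (i + 1),
    ∑ β ∈ (Fintype.piFinset fun _ : Fin n => Finset.range (2 * i + 1)).filter
        (fun β => (∑ k, β k) + 2 * l ≤ 2 * i),
      eLpNorm (dXmulti β (dT^[l] g)) (ENNReal.ofReal p) (stripMeasure n T)

/-- Time-regularity seminorm `[g]_{t,β,p,T}`. -/
def semT {n : ℕ} (b p : ℝ) (T : ℝ≥0∞) (g : Rn1 n → ℂ) : ℝ≥0∞ :=
  (∫⁻ X : Rn n, ∫⁻ t in tSet T, ∫⁻ s in tSet T,
      ENNReal.ofReal (‖g (X, t) - g (X, s)‖ ^ p / |t - s| ^ (1 + p * b / 2))) ^ (1 / p)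

/-- Space-regularity seminorm `[g]_{x,β,p,T}`. -/
def semX {n : ℕ} (b p : ℝ) (T : ℝ≥0∞) (g : Rn1 n → ℂ) : ℝ≥0∞ :=
  (∫⁻ t in tSet T, ∫⁻ X : Rn n, ∫⁻ Y : Rn n,
      ENNReal.ofReal (‖g (X + Y, t) - 2 * g (X, t) + g (X - Y, t)‖ ^ p /
        ‖Y‖ ^ ((n : ℝ) + p * b))) ^ (1 / p)

/-- The parabolic Besov norm `‖g‖_{B^{α,α/2}_p(ℝⁿ_T)}`, formed with index `i` where
`2i < α < 2i+2`. -/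
def pbNorm {n : ℕ} (i : ℕ) (α p : ℝ) (T : ℝ≥0∞) (g : Rn1 n → ℂ) : ℝ≥0∞ :=
  wNorm i p T g +
  ∑ l ∈ Finset.range (i + 1),
    ∑ β ∈ (Fintype.piFinset fun _ : Fin n => Finset.range (2 * i + 1)).filter
        (fun β => (∑ k, β k) + 2 * l = 2 * i),
      (semT (α - 2 * i) p T (dXmulti β (dT^[l] g)) +
        semX (α - 2 * i) p T (dXmulti β (dT^[l] g)))

/-- Fourier transform on `ℝⁿ`. -/
def FTn {n : ℕ} (f : Rn n → ℂ) (ξ : Rn n) : ℂ :=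
  ∫ x : Rn n, Complex.exp (-(2 * (π : ℂ) * Complex.I) * (((∑ k, x k * ξ k : ℝ)) : ℂ)) * f x

/-- Inverse Fourier transform on `ℝⁿ`. -/
def IFTn {n : ℕ} (f : Rn n → ℂ) (x : Rn n) : ℂ :=
  ∫ ξ : Rn n, Complex.exp ((2 * (π : ℂ) * Complex.I) * (((∑ k, ξ k * x k : ℝ)) : ℂ)) * f ξ

/-- Convolution on `ℝⁿ`. -/
def convn {n : ℕ} (g f : Rn n → ℂ) : Rn n → ℂ := fun x => ∫ y : Rn n, g (x - y) * f y

/-- A Littlewood–Paley family on `ℝⁿ`. -/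
structure LPFamily (n : ℕ) where
  φ : SchwartzMap (Rn n) ℂ
  ψ : SchwartzMap (Rn n) ℂ
  ft_pos : ∀ ξ : Rn n, 1 / 2 < ‖ξ‖ → ‖ξ‖ < 2 →
    0 < (FTn (⇑φ) ξ).re ∧ (FTn (⇑φ) ξ).im = 0
  ft_supp : ∀ ξ : Rn n, ¬(1 / 2 < ‖ξ‖ ∧ ‖ξ‖ < 2) → FTn (⇑φ) ξ = 0
  ft_sum : ∀ ξ : Rn n, ξ ≠ 0 → ∑' i : ℤ, FTn (⇑φ) (((2 : ℝ) ^ (-i)) • ξ) = 1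
  ft_psi : ∀ ξ : Rn n,
    FTn (⇑ψ) ξ = 1 - ∑' i : ℕ, FTn (⇑φ) (((2 : ℝ) ^ (-((i : ℤ) + 1))) • ξ)

/-- The dilate `φ′_i(x) = 2^{in} φ′(2^i x)`. -/
def lpPhin {n : ℕ} (P : LPFamily n) (i : ℕ) : Rn n → ℂ :=
  fun x => (((2 : ℝ) ^ (i * n) : ℝ) : ℂ) * P.φ (((2 : ℝ) ^ i) • x)

/-- Besov norm `B_{s,p}(f)` on `ℝⁿ`, `1 ≤ p < ∞`. -/
def besovN {n : ℕ} (P : LPFamily n) (s p : ℝ) (f : Rn n → ℂ) : ℝ≥0∞ :=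
  eLpNorm (convn (⇑P.ψ) f) (ENNReal.ofReal p) volume +
  (∑' i : ℕ,
    (ENNReal.ofReal ((2 : ℝ) ^ (s * ((i : ℝ) + 1))) *
      eLpNorm (convn (lpPhin P (i + 1)) f) (ENNReal.ofReal p) volume) ^ p) ^ (1 / p)

/-- The heat kernel `Γ(X,t)` on `ℝⁿ` (zero for `t ≤ 0`). -/
def heatKer (n : ℕ) (X : Rn n) (t : ℝ) : ℝ :=
  if 0 < t then (4 * π * t) ^ (-(n : ℝ) / 2) * Real.exp (-‖X‖ ^ 2 / (4 * t)) else 0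

/-- The heat extension `u(X,t) = ∫ Γ(X−Y,t) f(Y) dY`. -/
def heatExt {n : ℕ} (f : Rn n → ℂ) : Rn1 n → ℂ :=
  fun x => ∫ Y : Rn n, (heatKer n (x.1 - Y) x.2 : ℂ) * f Y

section HeatExtension

open FourierTransform Convolution

variable {n : ℕ}

theorem FTn_eq_fourier (f : Rn n → ℂ) : FTn f = 𝓕 f := by
  ext ξ
  rw [Real.fourier_eq', FTn]
  congr 1 with x
  rw [smul_eq_mul]
  congr 2
  simp only [PiLp.inner_apply, RCLike.inner_apply, conj_trivial]
  push_cast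
  rw [show ∑ k, (ξ k : ℂ) * (x k : ℂ) = ∑ k, (x k : ℂ) * (ξ k : ℂ) from
    Finset.sum_congr rfl fun _ _ => mul_comm _ _]
  ring

theorem convn_eq_convolution (g f : Rn n → ℂ) :
    convn g f = g ⋆[ContinuousLinearMap.mul ℂ ℂ] f := by
  ext x
  rw [convolution_eq_swap]
  rfl

theorem heatExt_eq_convn (f : Rn n → ℂ) (t : ℝ) :
    (fun X => heatExt f (X, t)) = convn (fun X => (heatKer n X t : ℂ)) f := rfl

theorem eq_of_fourier_eq {g h : Rn n → ℂ} (hg : Continuous g) (hh : Continuous h)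
    (hgi : Integrable g) (hhi : Integrable h) (hF : Integrable (𝓕 g)) (hgh : 𝓕 g = 𝓕 h) :
    g = h := by
  rw [← hg.fourierInv_fourier_eq hgi hF, hgh, hh.fourierInv_fourier_eq hhi (hgh ▸ hF)]

theorem integrable_convn {g f : Rn n → ℂ} (hg : Integrable g) (hf : Integrable f) :
    Integrable (convn g f) := by
  rw [convn_eq_convolution]
  exact hg.integrable_convolution _ hf

theorem continuous_convn {g f : Rn n → ℂ} (hg : Integrable g) (hf : Continuous f)
    {M : ℝ} (hM : ∀ x, ‖f x‖ ≤ M) : Continuous (convn g f) := by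
  rw [convn_eq_convolution]
  refine BddAbove.continuous_convolution_right_of_integrable _ ?_ hg hf
  exact ⟨M, by rintro _ ⟨y, rfl⟩; exact hM y⟩

theorem norm_convn_le {g f : Rn n → ℂ} (hg : Integrable g) {M : ℝ} (hM : ∀ x, ‖f x‖ ≤ M)
    (x : Rn n) : ‖convn g f x‖ ≤ (∫ y, ‖g y‖) * M := by
  calc ‖convn g f x‖ ≤ ∫ y, ‖g (x - y)‖ * M := by
        refine norm_integral_le_of_norm_le ((hg.comp_sub_left x).norm.mul_const M) ?_
        filter_upwards with y
        rw [norm_mul]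
        gcongr
        exact hM y
    _ = (∫ y, ‖g y‖) * M := by
        rw [integral_mul_const, integral_sub_left_eq_self (fun y => ‖g y‖)]

theorem fourier_convn {g f : Rn n → ℂ} (hg : Integrable g) (hf : Integrable f) (ξ : Rn n) :
    𝓕 (convn g f) ξ = 𝓕 g ξ * 𝓕 f ξ := by
  rw [convn_eq_convolution]
  exact Real.fourier_mul_convolution_eq hg hf ξ

theorem continuous_heatKer {t : ℝ} (ht : 0 < t) : Continuous fun X : Rn n => heatKer n X t := by
  simp only [heatKer, ht, if_true]
  fun_prop

theorem heatKer_nonneg (X : Rn n) (t : ℝ) : 0 ≤ heatKer n X t := by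
  unfold heatKer
  split_ifs <;> positivity

theorem heatKer_ofReal {t : ℝ} (ht : 0 < t) (X : Rn n) :
    (heatKer n X t : ℂ) = (((4 * π * t) ^ (-(n : ℝ) / 2) : ℝ) : ℂ) *
      cexp (-(((1 / (4 * t) : ℝ) : ℂ)) * ‖X‖ ^ 2) := by
  rw [heatKer, if_pos ht]
  push_cast
  congr 2
  ring

theorem integrable_heatKer {t : ℝ} (ht : 0 < t) :
    Integrable fun X : Rn n => (heatKer n X t : ℂ) := by
  simp_rw [heatKer_ofReal ht]
  refine Integrable.const_mul ?_ _
  have := GaussianFourier.integrable_cexp_neg_mul_sq_norm_add (V := Rn n)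
    (b := ((1 / (4 * t) : ℝ) : ℂ)) (by rw [ofReal_re]; positivity) 0 0
  simpa using this

theorem fourier_heatKer {t : ℝ} (ht : 0 < t) (ξ : Rn n) :
    𝓕 (fun X : Rn n => (heatKer n X t : ℂ)) ξ = (Real.exp (-(4 * π ^ 2 * t * ‖ξ‖ ^ 2)) : ℂ) := by
  have hb : 0 < (((1 / (4 * t) : ℝ) : ℂ)).re := by rw [ofReal_re]; positivity
  have hF := fourier_gaussian_innerProductSpace (V := Rn n) hb ξ
  have hsm : (fun X : Rn n => (heatKer n X t : ℂ)) =
      (((4 * π * t) ^ (-(n : ℝ) / 2) : ℝ) : ℂ) •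
        fun X : Rn n => cexp (-(((1 / (4 * t) : ℝ) : ℂ)) * ‖X‖ ^ 2) := by
    ext X
    rw [heatKer_ofReal ht]
    rfl
  have hconst : (((4 * π * t) ^ (-(n : ℝ) / 2) : ℝ) : ℂ) *
      ((π : ℂ) / ((1 / (4 * t) : ℝ) : ℂ)) ^ ((n : ℂ) / 2) = 1 := by
    have : ((π : ℂ) / ((1 / (4 * t) : ℝ) : ℂ)) ^ ((n : ℂ) / 2) =
        (((4 * π * t) ^ ((n : ℝ) / 2) : ℝ) : ℂ) := by
      rw [ofReal_cpow (by positivity)]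
      push_cast
      congr 1
      field_simp
    rw [this, ← ofReal_mul, ← Real.rpow_add (by positivity)]
    rw [show -(n : ℝ) / 2 + n / 2 = 0 by ring]
    simp
  rw [hsm, Real.fourier_eq]
  simp only [Pi.smul_apply, smul_comm (_ : Circle) (_ : ℂ) (_ : ℂ)]
  rw [integral_smul, ← Real.fourier_eq, hF, smul_eq_mul, ← mul_assoc,
    finrank_euclideanSpace_fin, hconst, one_mul]
  push_cast
  congr 1
  have : (t : ℂ) ≠ 0 := by exact_mod_cast ht.ne'
  field_simp

theorem lintegral_enorm_heatKer {t : ℝ} (ht : 0 < t) :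
    ∫⁻ X : Rn n, ‖(heatKer n X t : ℂ)‖ₑ = 1 := by
  have h0 := fourier_heatKer (n := n) ht 0
  rw [Real.fourier_eq] at h0
  simp only [inner_zero_right, neg_zero, AddChar.map_zero_eq_one, one_smul, norm_zero] at h0
  rw [integral_complex_ofReal] at h0
  have h1 : ∫ X : Rn n, heatKer n X t = 1 := by
    have : ((∫ X : Rn n, heatKer n X t : ℝ) : ℂ) = 1 := by simpa using h0
    exact_mod_cast this
  rw [← ofReal_integral_norm_eq_lintegral_enorm (integrable_heatKer ht)]
  simp only [norm_real, Real.norm_of_nonneg (heatKer_nonneg _ _), h1, ENNReal.ofReal_one]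

/-- If `ĝ(ξ) = k̂(ξ) e^{-4π²t|ξ|²}`, then `g * f` is recovered from the heat extension of `f` at
time `t` by convolution with `k`. -/
theorem convn_eq_convn_heatExt {g k : Rn n → ℂ} (hg : Integrable g) (hk : Integrable k)
    {t : ℝ} (ht : 0 < t)
    (hgk : ∀ ξ, 𝓕 g ξ = 𝓕 k ξ * (Real.exp (-(4 * π ^ 2 * t * ‖ξ‖ ^ 2)) : ℂ))
    (f : SchwartzMap (Rn n) ℂ) :
    convn g f = convn k fun X => heatExt f (X, t) := by
  have hfM : ∀ x, ‖f x‖ ≤ SchwartzMap.seminorm ℝ 0 0 f := f.norm_le_seminorm ℝ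
  have hfi : Integrable f := f.integrable
  have hΓ := integrable_heatKer (n := n) ht
  rw [heatExt_eq_convn]
  have hui := integrable_convn hΓ hfi
  refine eq_of_fourier_eq (continuous_convn hg f.continuous hfM)
    (continuous_convn hk (continuous_convn hΓ f.continuous hfM) (norm_convn_le hΓ hfM))
    (integrable_convn hg hfi) (integrable_convn hk hui) ?_ ?_
  · have hFf : Integrable (𝓕 (f : Rn n → ℂ)) := by
      rw [← SchwartzMap.fourier_coe]
      exact (𝓕 f).integrable
    have : 𝓕 (convn g f) = fun ξ => 𝓕 g ξ * 𝓕 (f : Rn n → ℂ) ξ :=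
      funext (fourier_convn hg hfi)
    rw [this]
    refine hFf.bdd_mul (c := ∫ x, ‖g x‖)
      (VectorFourier.fourierIntegral_continuous Real.continuous_fourierChar
        continuous_inner hg).aestronglyMeasurable ?_
    filter_upwards with ξ
    exact VectorFourier.norm_fourierIntegral_le_integral_norm _ _ _ _ _
  · ext ξ
    rw [fourier_convn hg hfi, fourier_convn hk hui, fourier_convn hΓ hfi, fourier_heatKer ht, hgk]
    ring

theorem lintegral_enorm_convn_rpow_le {p : ℝ} (hp : 1 ≤ p) {k u : Rn n → ℂ}
    (hk : AEStronglyMeasurable k) (hu : AEStronglyMeasurable u) :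
    ∫⁻ x, ‖convn k u x‖ₑ ^ p ≤ (∫⁻ x, ‖k x‖ₑ) ^ p * ∫⁻ x, ‖u x‖ₑ ^ p := by
  have hp0 : 0 < p := by linarith
  set A := ∫⁻ x, ‖k x‖ₑ with hA
  have hpt : ∀ x, ‖convn k u x‖ₑ ^ p ≤ A ^ (p - 1) * ∫⁻ y, ‖k (x - y)‖ₑ * ‖u y‖ₑ ^ p := by
    intro x
    have hkx : AEMeasurable (fun y => ‖k (x - y)‖ₑ) :=
      (hk.comp_quasiMeasurePreserving
        (quasiMeasurePreserving_sub_left_of_right_invariant volume x)).enorm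
    have h1 : ‖convn k u x‖ₑ ≤
        ∫⁻ y, ‖k (x - y)‖ₑ ^ (1 - 1 / p) * (‖k (x - y)‖ₑ * ‖u y‖ₑ ^ p) ^ (1 / p) := by
      refine (enorm_integral_le_lintegral_enorm _).trans (lintegral_mono fun y => ?_)
      rw [enorm_mul, ENNReal.mul_rpow_of_nonneg _ _ (by positivity), ← mul_assoc,
        ← ENNReal.rpow_add_of_nonneg _ _ (by rw [sub_nonneg, div_le_one hp0]; exact hp)
          (by positivity), ← ENNReal.rpow_mul, mul_one_div_cancel hp0.ne']
      simp
    have h2 := h1.trans (ENNReal.lintegral_mul_norm_pow_le hkx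
      (hkx.mul (hu.enorm.pow_const p)) (p := 1 - 1 / p) (q := 1 / p)
      (by rw [sub_nonneg, div_le_one hp0]; exact hp) (by positivity) (by ring))
    refine (ENNReal.rpow_le_rpow h2 hp0.le).trans (le_of_eq ?_)
    rw [ENNReal.mul_rpow_of_nonneg _ _ hp0.le, ← ENNReal.rpow_mul, ← ENNReal.rpow_mul,
      one_div_mul_cancel hp0.ne', ENNReal.rpow_one, lintegral_sub_left_eq_self (fun y => ‖k y‖ₑ) x]
    congr 2
    field_simp
  calc ∫⁻ x, ‖convn k u x‖ₑ ^ p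
      ≤ ∫⁻ x, A ^ (p - 1) * ∫⁻ y, ‖k (x - y)‖ₑ * ‖u y‖ₑ ^ p := lintegral_mono hpt
    _ ≤ A ^ (p - 1) * ∫⁻ x, ∫⁻ y, ‖k (x - y)‖ₑ * ‖u y‖ₑ ^ p := by
        rw [lintegral_const_mul'']
        have hm : AEMeasurable (fun z : Rn n × Rn n => ‖k (z.1 - z.2)‖ₑ * ‖u z.2‖ₑ ^ p)
            (volume.prod volume) :=
          (hk.comp_quasiMeasurePreserving
            (quasiMeasurePreserving_sub volume volume)).enorm.mul
              (hu.comp_snd.enorm.pow_const p)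
        exact hm.lintegral_prod_right'
    _ = A ^ (p - 1) * (A * ∫⁻ x, ‖u x‖ₑ ^ p) := by
        rw [lintegral_lintegral_swap]
        · congr 1
          rw [← lintegral_const_mul'' _ (hu.enorm.pow_const p)]
          congr 1 with y
          have hky : AEMeasurable (fun x => ‖k (x - y)‖ₑ) :=
            (hk.comp_measurePreserving (measurePreserving_sub_right volume y)).enorm
          rw [lintegral_mul_const'' _ hky,
            lintegral_sub_right_eq_self (fun x => ‖k x‖ₑ) y]
        · exact (hk.comp_quasiMeasurePreserving
            (quasiMeasurePreserving_sub volume volume)).enorm.mul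
              (hu.comp_snd.enorm.pow_const p)
    _ = A ^ p * ∫⁻ x, ‖u x‖ₑ ^ p := by
        rw [← mul_assoc]
        congr 1
        nth_rw 2 [← ENNReal.rpow_one A]
        rw [← ENNReal.rpow_add_of_nonneg _ _ (by linarith) zero_le_one, sub_add_cancel]

theorem lintegral_enorm_heatExt_anti {p : ℝ} (hp : 1 ≤ p) (f : SchwartzMap (Rn n) ℂ) {s t : ℝ}
    (hs : 0 < s) (hst : s ≤ t) :
    ∫⁻ X, ‖heatExt f (X, t)‖ₑ ^ p ≤ ∫⁻ X, ‖heatExt f (X, s)‖ₑ ^ p := by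
  rcases hst.eq_or_lt with rfl | hlt
  · exact le_rfl
  have hd : 0 < t - s := sub_pos.2 hlt
  have hu := heatExt_eq_convn (f : Rn n → ℂ) t
  rw [convn_eq_convn_heatExt (integrable_heatKer (hs.trans hlt)) (integrable_heatKer hd) hs
    (fun ξ => by
      rw [fourier_heatKer (hs.trans hlt), fourier_heatKer hd, ← ofReal_mul, ← Real.exp_add]
      congr 2
      ring) f] at hu
  have hus : AEStronglyMeasurable (fun X => heatExt f (X, s)) :=
    (integrable_convn (integrable_heatKer hs) f.integrable).aestronglyMeasurable
  have := lintegral_enorm_convn_rpow_le hp (integrable_heatKer hd).aestronglyMeasurable hus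
  rw [← hu, lintegral_enorm_heatKer hd] at this
  simpa using this

theorem lintegral_enorm_convn_le_heatExt {p : ℝ} (hp : 1 ≤ p) {g k : Rn n → ℂ}
    (hg : Integrable g) (hk : Integrable k) {t : ℝ}
    (hgk : ∀ ξ, 𝓕 g ξ = 𝓕 k ξ * (Real.exp (-(4 * π ^ 2 * t * ‖ξ‖ ^ 2)) : ℂ))
    (f : SchwartzMap (Rn n) ℂ) {s : ℝ} (hs : 0 < s) (hst : s ≤ t) :
    ∫⁻ x, ‖convn g f x‖ₑ ^ p ≤ (∫⁻ x, ‖k x‖ₑ) ^ p * ∫⁻ X, ‖heatExt f (X, s)‖ₑ ^ p := by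
  have ht := hs.trans_le hst
  rw [convn_eq_convn_heatExt hg hk ht hgk f]
  have hut : AEStronglyMeasurable (fun X => heatExt f (X, t)) :=
    (integrable_convn (integrable_heatKer ht) f.integrable).aestronglyMeasurable
  refine (lintegral_enorm_convn_rpow_le hp hk.aestronglyMeasurable hut).trans ?_
  exact mul_le_mul' le_rfl (lintegral_enorm_heatExt_anti hp f hs hst)

/-- A band-limited Schwartz function factors through the heat kernel at any time `t`. -/
theorem exists_fourier_eq_mul_heat (φ : SchwartzMap (Rn n) ℂ) {R : ℝ}
    (hφ : ∀ ξ, R ≤ ‖ξ‖ → 𝓕 (φ : Rn n → ℂ) ξ = 0) (t : ℝ) :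
    ∃ k : SchwartzMap (Rn n) ℂ, ∀ ξ, 𝓕 (φ : Rn n → ℂ) ξ =
      𝓕 (k : Rn n → ℂ) ξ * (Real.exp (-(4 * π ^ 2 * t * ‖ξ‖ ^ 2)) : ℂ) := by
  set m : Rn n → ℂ := fun ξ => (Real.exp (4 * π ^ 2 * t * ‖ξ‖ ^ 2) : ℂ) * (𝓕 φ) ξ with hm
  have hsupp : HasCompactSupport m := by
    refine HasCompactSupport.intro (isCompact_closedBall (0 : Rn n) R) fun ξ hξ => ?_
    rw [mem_closedBall_zero_iff, not_le] at hξ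
    rw [hm, SchwartzMap.fourier_coe]
    simp only [hφ ξ hξ.le, mul_zero]
  have hsm : ContDiff ℝ (⊤ : ℕ∞) m := by
    refine ContDiff.mul ?_ ((𝓕 φ).smooth _)
    refine ofRealCLM.contDiff.comp (Real.contDiff_exp.comp ?_)
    exact contDiff_const.mul (contDiff_norm_sq ℝ)
  refine ⟨𝓕⁻ (hsupp.toSchwartzMap hsm), fun ξ => ?_⟩
  rw [← SchwartzMap.fourier_coe, ← SchwartzMap.fourier_coe, FourierTransform.fourier_fourierInv_eq,
    HasCompactSupport.toSchwartzMap_toFun, hm]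
  simp only
  rw [mul_right_comm, ← ofReal_mul, ← Real.exp_add]
  simp

/-- The `L¹`-normalised dilate `aⁿ g(a x)`. -/
def dilate (a : ℝ) (g : Rn n → ℂ) : Rn n → ℂ := fun x => ((a ^ n : ℝ) : ℂ) * g (a • x)

theorem lpPhin_eq_dilate (P : LPFamily n) (i : ℕ) : lpPhin P i = dilate (2 ^ i) P.φ := by
  ext x
  rw [lpPhin, dilate, pow_mul]

theorem integrable_dilate {a : ℝ} (ha : 0 < a) {g : Rn n → ℂ} (hg : Integrable g) :
    Integrable (dilate a g) :=
  (hg.comp_smul ha.ne').const_mul _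

theorem fourier_dilate {a : ℝ} (ha : 0 < a) (g : Rn n → ℂ) (ξ : Rn n) :
    𝓕 (dilate a g) ξ = 𝓕 g (a⁻¹ • ξ) := by
  rw [Real.fourier_eq, Real.fourier_eq]
  have h := Measure.integral_comp_smul volume
    (fun y : Rn n => Real.fourierChar (-inner ℝ y (a⁻¹ • ξ)) • g y) a
  have hpt : ∀ x : Rn n, Real.fourierChar (-inner ℝ x ξ) • dilate a g x =
      ((a ^ n : ℝ) : ℂ) •
        (Real.fourierChar (-inner ℝ (a • x) (a⁻¹ • ξ)) • g (a • x)) := by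
    intro x
    rw [real_inner_smul_left, real_inner_smul_right, mul_inv_cancel_left₀ ha.ne', smul_comm]
    rfl
  simp_rw [hpt]
  rw [integral_smul, h, finrank_euclideanSpace_fin, abs_of_pos (by positivity),
    Complex.coe_smul, smul_smul, mul_inv_cancel₀ (by positivity), one_smul]

theorem lintegral_enorm_dilate {a : ℝ} (ha : 0 < a) {g : Rn n → ℂ} (hg : Integrable g) :
    ∫⁻ x, ‖dilate a g x‖ₑ = ∫⁻ x, ‖g x‖ₑ := by
  rw [← ofReal_integral_norm_eq_lintegral_enorm (integrable_dilate ha hg),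
    ← ofReal_integral_norm_eq_lintegral_enorm hg]
  congr 1
  simp only [dilate, norm_mul, norm_real]
  rw [integral_const_mul, Measure.integral_comp_smul volume (fun y => ‖g y‖),
    finrank_euclideanSpace_fin, abs_of_pos (by positivity), smul_eq_mul,
    Real.norm_of_nonneg (by positivity), mul_inv_cancel_left₀ (by positivity)]

theorem LPFamily.fourier_φ_eq_zero (P : LPFamily n) {ξ : Rn n} (hξ : 2 ≤ ‖ξ‖) :
    𝓕 (P.φ : Rn n → ℂ) ξ = 0 := by
  rw [← FTn_eq_fourier]
  exact P.ft_supp ξ fun h => absurd h.2 (not_lt.2 hξ)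

theorem LPFamily.fourier_ψ_eq_zero (P : LPFamily n) {ξ : Rn n} (hξ : 2 ≤ ‖ξ‖) :
    𝓕 (P.ψ : Rn n → ℂ) ξ = 0 := by
  have hξ0 : ξ ≠ 0 := by
    rintro rfl
    norm_num at hξ
  rw [← FTn_eq_fourier, P.ft_psi, ← P.ft_sum ξ hξ0, sub_eq_zero]
  have hinj : Function.Injective fun i : ℕ => (i : ℤ) + 1 := fun a b h => by simpa using h
  refine (hinj.tsum_eq (f := fun i : ℤ => FTn P.φ (((2 : ℝ) ^ (-i)) • ξ)) ?_).symm
  intro i hi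
  by_contra hne
  refine hi (P.ft_supp _ fun h => absurd h.2 (not_lt.2 ?_))
  have hi0 : i ≤ 0 := by
    by_contra hpos
    exact hne ⟨(i - 1).toNat, by simp only; omega⟩
  rw [norm_smul, Real.norm_of_nonneg (by positivity)]
  have : (1 : ℝ) ≤ 2 ^ (-i) := one_le_zpow₀ one_le_two (by omega)
  nlinarith [norm_nonneg ξ]

theorem measurable_heatKer : Measurable fun q : Rn n × ℝ => heatKer n q.1 q.2 := by
  unfold heatKer
  refine Measurable.ite (measurableSet_lt measurable_const measurable_snd) ?_ measurable_const
  fun_prop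

theorem stronglyMeasurable_heatExt (f : SchwartzMap (Rn n) ℂ) :
    StronglyMeasurable (heatExt (f : Rn n → ℂ)) := by
  have : Measurable fun z : Rn1 n × Rn n =>
      (heatKer n (z.1.1 - z.2) z.1.2 : ℂ) * f z.2 := by
    have hz : Measurable fun z : Rn1 n × Rn n => (z.1.1 - z.2, z.1.2) := by fun_prop
    exact (Complex.measurable_ofReal.comp (measurable_heatKer.comp hz)).mul
      (f.continuous.measurable.comp measurable_snd)
  exact this.stronglyMeasurable.integral_prod_right

theorem tSet_ofReal {T : ℝ} (hT : 0 < T) : tSet (ENNReal.ofReal T) = Set.Ioo 0 T := by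
  ext t
  simp [tSet, ENNReal.ofReal_lt_ofReal_iff hT]

theorem eLpNorm_eq_lintegral_enorm_rpow {α : Type*} [MeasurableSpace α] {μ : Measure α} {p : ℝ}
    (hp : 1 ≤ p) (g : α → ℂ) :
    eLpNorm g (ENNReal.ofReal p) μ = (∫⁻ x, ‖g x‖ₑ ^ p ∂μ) ^ (1 / p) := by
  rw [eLpNorm_eq_lintegral_rpow_enorm_toReal (by simp; linarith) ENNReal.ofReal_ne_top,
    ENNReal.toReal_ofReal (by linarith)]

theorem lintegral_stripMeasure {T : ℝ} (hT : 0 < T) {F : Rn1 n → ℝ≥0∞} (hF : Measurable F) :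
    ∫⁻ x, F x ∂stripMeasure n (ENNReal.ofReal T) = ∫⁻ t in Set.Ioo 0 T, ∫⁻ X, F (X, t) := by
  have : {x : Rn1 n | x.2 ∈ tSet (ENNReal.ofReal T)} = Set.univ ×ˢ Set.Ioo 0 T := by
    ext x
    simp [tSet_ofReal hT]
  rw [stripMeasure, this, Measure.volume_eq_prod, ← Measure.prod_restrict,
    lintegral_prod_symm _ hF.aemeasurable, Measure.restrict_univ]

theorem ofReal_mul_le_setLIntegral_Ioo {a : ℝ≥0∞} {G : ℝ → ℝ≥0∞} {x y : ℝ}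
    (h : ∀ t ∈ Set.Ioo x y, a ≤ G t) :
    ENNReal.ofReal (y - x) * a ≤ ∫⁻ t in Set.Ioo x y, G t := by
  calc ENNReal.ofReal (y - x) * a = ∫⁻ _ in Set.Ioo x y, a := by
        rw [setLIntegral_const, Real.volume_Ioo, mul_comm]
    _ ≤ _ := setLIntegral_mono' measurableSet_Ioo h

theorem lintegral_convn_ψ_le {p : ℝ} (hp : 1 ≤ p) {T : ℝ} (hT : 0 < T) (P : LPFamily n) :
    ∃ B : ℝ≥0∞, B ≠ ⊤ ∧ ∀ f : SchwartzMap (Rn n) ℂ,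
      ∫⁻ x, ‖convn P.ψ f x‖ₑ ^ p ≤ B * ∫⁻ t in Set.Ioo 0 T, ∫⁻ X, ‖heatExt f (X, t)‖ₑ ^ p := by
  obtain ⟨k, hk⟩ := exists_fourier_eq_mul_heat P.ψ (fun _ => P.fourier_ψ_eq_zero) T
  have hA : (∫⁻ x, ‖k x‖ₑ) ^ p ≠ ⊤ :=
    ENNReal.rpow_ne_top_of_nonneg (by linarith) k.integrable.2.ne
  have hT0 : ENNReal.ofReal T ≠ 0 := by simpa using hT
  refine ⟨(ENNReal.ofReal T)⁻¹ * (∫⁻ x, ‖k x‖ₑ) ^ p,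
    ENNReal.mul_ne_top (ENNReal.inv_ne_top.2 hT0) hA, fun f => ?_⟩
  have h := ofReal_mul_le_setLIntegral_Ioo (x := 0) (y := T) fun t ht =>
    lintegral_enorm_convn_le_heatExt hp P.ψ.integrable k.integrable hk f ht.1 ht.2.le
  rwa [lintegral_const_mul' _ _ hA, sub_zero, mul_comm,
    ← ENNReal.le_div_iff_mul_le (Or.inl hT0) (Or.inl ENNReal.ofReal_ne_top),
    ENNReal.div_eq_inv_mul, ← mul_assoc] at h

theorem tsum_lintegral_convn_lpPhin_le {p : ℝ} (hp : 1 ≤ p) {T : ℝ} (hT : 0 < T)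
    (P : LPFamily n) :
    ∃ B : ℝ≥0∞, B ≠ ⊤ ∧ ∀ f : SchwartzMap (Rn n) ℂ,
      ∑' i : ℕ, ENNReal.ofReal ((4 ^ (i + 1))⁻¹) * ∫⁻ x, ‖convn (lpPhin P (i + 1)) f x‖ₑ ^ p ≤
        B * ∫⁻ t in Set.Ioo 0 T, ∫⁻ X, ‖heatExt f (X, t)‖ₑ ^ p := by
  obtain ⟨k, hk⟩ := exists_fourier_eq_mul_heat P.φ (fun _ => P.fourier_φ_eq_zero) (4 * T)
  have hA : (∫⁻ x, ‖k x‖ₑ) ^ p ≠ ⊤ :=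
    ENNReal.rpow_ne_top_of_nonneg (by linarith) k.integrable.2.ne
  have hT0 : ENNReal.ofReal (3 * T) ≠ 0 := by simpa using hT
  refine ⟨(ENNReal.ofReal (3 * T))⁻¹ * (∫⁻ x, ‖k x‖ₑ) ^ p,
    ENNReal.mul_ne_top (ENNReal.inv_ne_top.2 hT0) hA, fun f => ?_⟩
  set G : ℝ → ℝ≥0∞ := fun t => ∫⁻ X, ‖heatExt f (X, t)‖ₑ ^ p with hG
  set x : ℕ → ℝ := fun i => T / 4 ^ i with hx
  have hxpos : ∀ i, 0 < x i := fun i => by positivity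
  have hanti : Antitone x := fun i j hij =>
    div_le_div_of_nonneg_left hT.le (by positivity) (pow_le_pow_right₀ (by norm_num) hij)
  have hterm : ∀ i : ℕ, ENNReal.ofReal (3 * T) * (ENNReal.ofReal ((4 ^ (i + 1))⁻¹) *
      ∫⁻ y, ‖convn (lpPhin P (i + 1)) f y‖ₑ ^ p) ≤
      (∫⁻ y, ‖k y‖ₑ) ^ p * ∫⁻ t in Set.Ioo (x (i + 1)) (x i), G t := by
    intro i
    have ha : (0 : ℝ) < 2 ^ (i + 1) := by positivity
    have hdil : ∀ ξ, 𝓕 (dilate (2 ^ (i + 1)) P.φ) ξ =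
        𝓕 (dilate (2 ^ (i + 1)) (k : Rn n → ℂ)) ξ *
          (Real.exp (-(4 * π ^ 2 * x i * ‖ξ‖ ^ 2)) : ℂ) := by
      intro ξ
      rw [fourier_dilate ha, fourier_dilate ha, hk, norm_smul, norm_inv,
        Real.norm_of_nonneg ha.le, mul_pow]
      congr 4
      have h4 : (4 : ℝ) ^ (i + 1) = (2 ^ (i + 1)) ^ 2 := by
        rw [← pow_mul, mul_comm, pow_mul]; norm_num
      have : x i = 4 * T / 4 ^ (i + 1) := by
        rw [hx]
        field_simp
        ring
      rw [this, h4]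
      field_simp
    have h := ofReal_mul_le_setLIntegral_Ioo (x := x (i + 1)) (y := x i) fun t ht =>
      lintegral_enorm_convn_le_heatExt hp (integrable_dilate ha P.φ.integrable)
        (integrable_dilate ha k.integrable) hdil f ((hxpos _).trans ht.1) ht.2.le
    rw [lintegral_enorm_dilate ha k.integrable, lintegral_const_mul' _ _ hA] at h
    rw [lpPhin_eq_dilate, ← mul_assoc, ← ENNReal.ofReal_mul (by positivity)]
    convert h using 3
    rw [hx]
    field_simp
    ring
  have hsum : ENNReal.ofReal (3 * T) * ∑' i : ℕ, ENNReal.ofReal ((4 ^ (i + 1))⁻¹) *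
      ∫⁻ y, ‖convn (lpPhin P (i + 1)) f y‖ₑ ^ p ≤
      (∫⁻ y, ‖k y‖ₑ) ^ p * ∫⁻ t in Set.Ioo 0 T, G t := by
    rw [← ENNReal.tsum_mul_left]
    refine (ENNReal.tsum_le_tsum hterm).trans ?_
    have hdisj : Pairwise (Function.onFun Disjoint fun i => Set.Ioo (x (i + 1)) (x i)) :=
      hanti.pairwise_disjoint_on_Ioo_succ
    rw [ENNReal.tsum_mul_left, ← lintegral_iUnion (fun _ => measurableSet_Ioo) hdisj]
    refine mul_le_mul' le_rfl (lintegral_mono_set (Set.iUnion_subset fun i => ?_))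
    refine Set.Ioo_subset_Ioo (hxpos _).le ?_
    simpa [hx] using hanti (Nat.zero_le i)
  rwa [mul_comm, ← ENNReal.le_div_iff_mul_le (Or.inl hT0) (Or.inl ENNReal.ofReal_ne_top),
    ENNReal.div_eq_inv_mul, ← mul_assoc] at hsum

end HeatExtension

/-- `B_{−2/p,p}(f) ≲ ‖u‖_{Lᵖ(ℝⁿ×(0,T))}` for the heat extension `u` of `f`. -/
theorem stmt15 (n : ℕ) (hn : 1 ≤ n) (p : ℝ) (hp : 1 ≤ p) (T : ℝ) (hT : 0 < T)
    (P : LPFamily n) :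
    ∃ C : ℝ, 0 < C ∧
      ∀ f : SchwartzMap (Rn n) ℂ,
        besovN P (-2 / p) p ⇑f
          ≤ ENNReal.ofReal C *
            eLpNorm (heatExt ⇑f) (ENNReal.ofReal p) (stripMeasure n (ENNReal.ofReal T)) := by
  have hp0 : 0 < p := by linarith
  obtain ⟨B, hB, hψ⟩ := lintegral_convn_ψ_le hp hT P
  obtain ⟨D, hD, hφ⟩ := tsum_lintegral_convn_lpPhin_le hp hT P
  have hfin : B ^ (1 / p) + D ^ (1 / p) ≠ ⊤ :=
    ENNReal.add_ne_top.2 ⟨ENNReal.rpow_ne_top_of_nonneg (by positivity) hB,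
      ENNReal.rpow_ne_top_of_nonneg (by positivity) hD⟩
  refine ⟨(B ^ (1 / p) + D ^ (1 / p)).toReal + 1, by positivity, fun f => ?_⟩
  have hC : B ^ (1 / p) + D ^ (1 / p) ≤
      ENNReal.ofReal ((B ^ (1 / p) + D ^ (1 / p)).toReal + 1) := by
    rw [ENNReal.le_ofReal_iff_toReal_le hfin (by positivity)]
    linarith
  refine le_trans ?_ (mul_le_mul' hC le_rfl)
  have hu : Measurable fun x => ‖heatExt (f : Rn n → ℂ) x‖ₑ ^ p :=
    (stronglyMeasurable_heatExt f).measurable.enorm.pow_const p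
  rw [eLpNorm_eq_lintegral_enorm_rpow hp, lintegral_stripMeasure hT hu, add_mul,
    ← ENNReal.mul_rpow_of_nonneg _ _ (by positivity),
    ← ENNReal.mul_rpow_of_nonneg _ _ (by positivity), besovN]
  refine add_le_add ?_ (ENNReal.rpow_le_rpow (le_of_eq_of_le ?_ (hφ f)) (by positivity))
  · rw [eLpNorm_eq_lintegral_enorm_rpow hp]
    exact ENNReal.rpow_le_rpow (hψ f) (by positivity)
  · congr 1 with i
    rw [eLpNorm_eq_lintegral_enorm_rpow hp, ENNReal.mul_rpow_of_nonneg _ _ hp0.le,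
      ← ENNReal.rpow_mul, one_div_mul_cancel hp0.ne', ENNReal.rpow_one,
      ENNReal.ofReal_rpow_of_nonneg (by positivity) hp0.le, ← Real.rpow_mul zero_le_two]
    congr 2
    rw [show -2 / p * ((i : ℝ) + 1) * p = -(2 * ((i + 1 : ℕ) : ℝ)) by
        push_cast
        field_simp,
      Real.rpow_neg zero_le_two, Real.rpow_mul zero_le_two, Real.rpow_natCast]
    norm_num
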